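/- For Hermitian positive definite matrices S_r and S_j, the deluxe-scaled matrix D_j^H S_r D_j + D_r^H S_j D_r, where D_r = (S_r+S_j)^{-1}S_r and D_j = (S_r+S_j)^{-1}S_j, equals S_j (S_r+S_j)^{-1} S_r, the parallel sum of S_r and S_j. -/

import Mathlib

open Matrix
open scoped ComplexOrder

/-- For Hermitian positive definite `S_r`, `S_j` with deluxe scalings
`D_r = (S_r+S_j)⁻¹ S_r`, `D_j = (S_r+S_j)⁻¹ S_j`, one has
`D_jᴴ S_r D_j + D_rᴴ S_j D_r = S_j (S_r+S_j)⁻¹ S_r` (the parallel sum). -/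
theorem deluxe_scaled_eq_parallel_sum {n : ℕ}
    (Sr Sj : Matrix (Fin n) (Fin n) ℂ) (hSr : Sr.PosDef) (hSj : Sj.PosDef) :
    ((Sr + Sj)⁻¹ * Sj)ᴴ * Sr * ((Sr + Sj)⁻¹ * Sj)
      + ((Sr + Sj)⁻¹ * Sr)ᴴ * Sj * ((Sr + Sj)⁻¹ * Sr)
      = Sj * (Sr + Sj)⁻¹ * Sr := by
  have hM : (Sr + Sj).PosDef := hSr.add hSj
  have hdet : IsUnit (Sr + Sj).det := (Matrix.isUnit_iff_isUnit_det _).1 hM.isUnit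
  have h1 : (Sr + Sj) * (Sr + Sj)⁻¹ = 1 := Matrix.mul_nonsing_inv _ hdet
  have h2 : (Sr + Sj)⁻¹ * (Sr + Sj) = 1 := Matrix.nonsing_inv_mul _ hdet
  have hT : ((Sr + Sj)⁻¹)ᴴ = (Sr + Sj)⁻¹ := hM.isHermitian.inv.eq
  rw [Matrix.conjTranspose_mul, Matrix.conjTranspose_mul, hT, hSr.isHermitian.eq,
    hSj.isHermitian.eq]
  generalize (Sr + Sj)⁻¹ = T at h1 h2
  have hcomm : Sr * T * Sj = Sj * T * Sr := by
    have e1 : Sr * T * Sr + Sr * T * Sj = Sr := by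
      rw [← mul_add, mul_assoc, h2, mul_one]
    have e2 : Sr * T * Sr + Sj * T * Sr = Sr := by
      rw [← add_mul, ← add_mul, h1, one_mul]
    exact add_left_cancel (e1.trans e2.symm)
  rw [hcomm, ← mul_add, ← mul_add, add_comm Sj Sr, h2, mul_one]
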